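/- arXiv:1511.00019 — 2 statements merged into one kernel-verified Lean document; each statement's English description precedes it below -/
import Mathlib

section
/- Let p ≥ 1, λ ≥ 1, and 1 ≤ k < j. Let E_k ⊂ ([2^k,2^{k+1}) ∩ ℕ) × ℤ^d be finite with #(E_k ∩ Q) ≤ λ^p l(Q) for every Q ∈ D_k, let (n,z) ∈ ([2^j,2^{j+1}) ∩ ℕ) × ℤ^d, and fix a constant C > 0. Define E_k(z) = { (n′,z′) ∈ E_k : 2^{j−5} ≤ ψ(z′−z) ≤ 2^{j+5} }, E_k^0(n,z) = { (n′,z′) ∈ E_k(z) : |ψ(z′−z) − n| < C 2^k }, and for l ≥ 1, E_k^l(n,z) = { (n′,z′) ∈ E_k(z) : C 2^{k+l−1} ≤ |ψ(z′−z) − n| < C 2^{k+l} }. Then for all l ≥ 0, #E_k^l(n,z) ≤ C′ λ^p 2^{(j−k)(d−1)} 2^{k+l}, where C′ depends only on d, C and a, not on (n,z). -/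
open MeasureTheory Real Set
open scoped Classical FourierTransform RealInnerProductSpace NNReal ENNReal

noncomputable section

/-- Euclidean space `ℝ^d`. -/
abbrev Rd (d : ℕ) := EuclideanSpace ℝ (Fin d)

/-- `a` is a "distance function": smooth away from the origin, positive away from the
origin, and homogeneous of degree one. -/
structure IsDistFn {d : ℕ} (a : Rd d → ℝ) : Prop where
  smooth : ContDiffOn ℝ (⊤ : ℕ∞) a {ξ : Rd d | ξ ≠ 0}
  pos : ∀ ξ : Rd d, ξ ≠ 0 → 0 < a ξ
  homog : ∀ t : ℝ, 0 < t → ∀ ξ : Rd d, a (t • ξ) = t * a ξ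

/-- Nonvanishing Gaussian curvature of the cosphere `Σ = {a = 1}`: at every point `ξ` of `Σ`
the second fundamental form, i.e. the Hessian of `a` restricted to the tangent space
`ker (da(ξ))`, is nondegenerate. -/
def CurvNondeg {d : ℕ} (a : Rd d → ℝ) : Prop :=
  ∀ ξ : Rd d, a ξ = 1 → ∀ v : Rd d, fderiv ℝ a ξ v = 0 → v ≠ 0 →
    ∃ w : Rd d, fderiv ℝ a ξ w = 0 ∧ iteratedFDeriv ℝ 2 a ξ ![v, w] ≠ 0

/-- The bump function `η`: smooth, supported in `[1/8,8]`, equal to `1` on `[1/4,4]`. -/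
structure IsBump (η : ℝ → ℝ) : Prop where
  smooth : ContDiff ℝ (⊤ : ℕ∞) η
  supp : ∀ x : ℝ, x ∉ Icc (1/8 : ℝ) 8 → η x = 0
  one : ∀ x ∈ Icc (1/4 : ℝ) 4, η x = 1

/-- The kernel `K_r`, given by the inverse Fourier transform of `ξ ↦ η(a(ξ)) e^{i r a(ξ)}`. -/
def Kker {d : ℕ} (a : Rd d → ℝ) (η : ℝ → ℝ) (r : ℝ) (x : Rd d) : ℂ :=
  ∫ ξ : Rd d, (η (a ξ) : ℂ) * Complex.exp (Complex.I * r * a ξ) *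
    Complex.exp (2 * π * Complex.I * (inner ℝ x ξ : ℝ))

/-- Convolution `K ∗ b`. -/
def conv {d : ℕ} (K b : Rd d → ℂ) (x : Rd d) : ℂ := ∫ y, K (x - y) * b y

/-- The measure `ν_d` on `ℝ`, `dν_d(r) = (1+|r|)^{d-1} dr`. -/
def nuMeas (d : ℕ) : Measure ℝ :=
  volume.withDensity fun r => ENNReal.ofReal ((1 + |r|) ^ (d - 1))

/-- The Lorentz quasinorm `‖f‖_{L^{p,q}(μ)}`. -/
def lorentzNorm {α : Type*} {E : Type*} [MeasurableSpace α] [NormedAddCommGroup E]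
    (μ : Measure α) (p : ℝ) (q : ℝ≥0∞) (f : α → E) : ℝ≥0∞ :=
  if q = ∞ then ⨆ t : ℝ, ENNReal.ofReal t * μ {x | t < ‖f x‖} ^ (1 / p)
  else (∫⁻ t in Ioi (0 : ℝ),
      (ENNReal.ofReal t * μ {x | t < ‖f x‖} ^ (1 / p)) ^ q.toReal / ENNReal.ofReal t) ^
      (1 / q.toReal)

/-- The unit cube `q_z = ∏ [z_i, z_i + 1)`. -/
def qcube (d : ℕ) (z : Fin d → ℤ) : Set (Rd d) :=
  {y : Rd d | ∀ i, (z i : ℝ) ≤ y i ∧ y i < z i + 1}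

/-- A normalized function `b_{n,z}`: measurable, bounded by the characteristic
function of `q_z`. -/
def IsNormalized {d : ℕ} (z : Fin d → ℤ) (b : Rd d → ℂ) : Prop :=
  Measurable b ∧ (∀ y, ‖b y‖ ≤ 1) ∧ ∀ y ∉ qcube d z, b y = 0

/-- A dyadic cube of side length `2^k`, `1 ≤ k ≤ j`, in the tiling of
`[2^j, 2^{j+1}) × ℝ^d`. -/
structure DyCube (d j : ℕ) where
  k : ℕ
  m : ℤ
  zv : Fin d → ℤ
  hk : 1 ≤ k ∧ k ≤ j
  hm : (2:ℤ) ^ (j - k) ≤ m ∧ m < 2 ^ (j + 1 - k)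

/-- side length of a dyadic cube -/
def DyCube.len {d j : ℕ} (Q : DyCube d j) : ℝ := 2 ^ Q.k

/-- a dyadic cube as a subset of `ℝ^{1+d}` -/
def DyCube.toSet {d j : ℕ} (Q : DyCube d j) : Set (ℝ × (Fin d → ℝ)) :=
  {p | ((Q.m : ℝ) * 2 ^ Q.k ≤ p.1 ∧ p.1 < (Q.m + 1) * 2 ^ Q.k) ∧
    ∀ i, (Q.zv i : ℝ) * 2 ^ Q.k ≤ p.2 i ∧ p.2 i < (Q.zv i + 1) * 2 ^ Q.k}

/-- center of a dyadic cube: the `r`-coordinate -/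
def DyCube.centerT {d j : ℕ} (Q : DyCube d j) : ℝ := ((Q.m : ℝ) + 1/2) * 2 ^ Q.k

/-- center of a dyadic cube: the `y`-coordinate -/
def DyCube.centerX {d j : ℕ} (Q : DyCube d j) : Rd d :=
  WithLp.toLp 2 fun i => ((Q.zv i : ℝ) + 1/2) * 2 ^ Q.k

/-- a point `(n,z) ∈ ℕ × ℤ^d` viewed as a point of `ℝ^{1+d}` -/
def embedPt (d : ℕ) (e : ℕ × (Fin d → ℤ)) : ℝ × (Fin d → ℝ) :=
  ((e.1 : ℝ), fun i => (e.2 i : ℝ))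

/-- the number of points of `E` lying in the cube `Q` -/
def cubeCount {d j : ℕ} (E : Finset (ℝ × (Fin d → ℝ))) (Q : DyCube d j) : ℕ :=
  (E.filter (· ∈ Q.toSet)).card

/-- `Q` is `λ`-dense: `#(E ∩ Q) > λ^p l(Q)` -/
def IsDense {d j : ℕ} (E : Finset (ℝ × (Fin d → ℝ))) (lam p : ℝ) (Q : DyCube d j) : Prop :=
  lam ^ p * Q.len < (cubeCount E Q : ℝ)

/-- `Q` is a maximal `λ`-dense dyadic cube -/
def IsMaxDense {d j : ℕ} (E : Finset (ℝ × (Fin d → ℝ))) (lam p : ℝ) (Q : DyCube d j) : Prop :=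
  IsDense E lam p Q ∧
    ∀ Q' : DyCube d j, IsDense E lam p Q' → Q.toSet ⊆ Q'.toSet → Q'.toSet = Q.toSet

/-- a lattice vector viewed as an element of `ℝ^d` -/
def latticeVec (d : ℕ) (z : Fin d → ℤ) : Rd d := WithLp.toLp 2 fun i => (z i : ℝ)

/-- The structural properties of the phase function `ψ = -ψ₋`: Lipschitz with constant `L`,
comparable to the norm, and homogeneous of degree one. -/
structure IsPsi {d : ℕ} (ψ : Rd d → ℝ) (L c₁ c₂ : ℝ) : Prop where
  lip : LipschitzWith (Real.toNNReal L) ψ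
  lower : ∀ x : Rd d, c₁ * ‖x‖ ≤ ψ x
  upper : ∀ x : Rd d, ψ x ≤ c₂ * ‖x‖
  homog : ∀ t : ℝ, 0 < t → ∀ x : Rd d, ψ (t • x) = t * ψ x

/-- The stationary phase kernel estimate for `K_r`, `r ≥ 2`:
`|K_r(x)| ≤ C_N (1+|x|+|r|)^{-(d-1)/2} (1+|ψ(x)-r|)^{-N}`. -/
def KernelEst {d : ℕ} (a : Rd d → ℝ) (η : ℝ → ℝ) (ψ : Rd d → ℝ) : Prop :=
  ∀ N : ℕ, ∃ C : ℝ, 0 < C ∧ ∀ r : ℝ, 2 ≤ r → ∀ x : Rd d,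
    ‖Kker a η r x‖ ≤ C * (1 + ‖x‖ + |r|) ^ (-(((d:ℝ) - 1) / 2)) * (1 + |ψ x - r|) ^ (-(N : ℝ))

/-- The two-sided stationary phase kernel estimate for `K_r`, `|r| ≥ 2`, with the
two phase functions `ψ₊`, `ψ₋`:
`|K_r(x)| ≤ C_N (1+|x|+|r|)^{-(d-1)/2} ∑_± (1+|ψ_±(x)+r|)^{-N}`. -/
def KernelEstPM {d : ℕ} (a : Rd d → ℝ) (η : ℝ → ℝ) (ψp ψm : Rd d → ℝ) : Prop :=
  ∀ N : ℕ, ∃ C : ℝ, 0 < C ∧ ∀ r : ℝ, 2 ≤ |r| → ∀ x : Rd d,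
    ‖Kker a η r x‖ ≤ C * (1 + ‖x‖ + |r|) ^ (-(((d:ℝ) - 1) / 2)) *
      ((1 + |ψp x + r|) ^ (-(N : ℝ)) + (1 + |ψm x + r|) ^ (-(N : ℝ)))

open scoped Pointwise in
/-- Measure of a shell between two level sets of a positive function homogeneous of degree one. -/
theorem measureReal_homogeneous_shell_le {E : Type*} [NormedAddCommGroup E] [NormedSpace ℝ E]
    [FiniteDimensional ℝ E] [Nontrivial E] [MeasurableSpace E] [BorelSpace E] (μ : Measure E)
    [μ.IsAddHaarMeasure] {φ : E → ℝ} (hcont : Continuous φ) {c : ℝ} (hc : 0 < c)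
    (hlow : ∀ x, c * ‖x‖ ≤ φ x) (hhom : ∀ t : ℝ, 0 < t → ∀ x, φ (t • x) = t * φ x)
    (r : ℝ) {δ R : ℝ} (hδ : 0 ≤ δ) (hR : 0 ≤ R) :
    μ {y | |φ y - r| < δ ∧ φ y < R} ≠ ∞ ∧ μ.real {y | |φ y - r| < δ ∧ φ y < R} ≤
      μ.real {y | φ y < 1} * (2 * δ * Module.finrank ℝ E * R ^ (Module.finrank ℝ E - 1)) := by
  have hnonneg : ∀ x, 0 ≤ φ x := fun x => (by positivity : 0 ≤ c * ‖x‖).trans (hlow x)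
  have hopen : ∀ t, MeasurableSet {y | φ y < t} :=
    fun t => (isOpen_lt hcont continuous_const).measurableSet
  have hfin : ∀ t, μ {y | φ y < t} ≠ ∞ := by
    intro t
    refine ((measure_mono ?_).trans_lt
      (measure_closedBall_lt_top (μ := μ) (x := (0 : E)) (r := t / c))).ne
    intro y hy
    rw [mem_closedBall_zero_iff, le_div_iff₀ hc]
    have h := hlow y
    have h' : φ y < t := hy
    linarith
  refine ⟨((measure_mono fun y hy => hy.2).trans_lt (hfin R).lt_top).ne, ?_⟩
  have hscale : ∀ t, 0 ≤ t →
      μ.real {y | φ y < t} = t ^ Module.finrank ℝ E * μ.real {y | φ y < 1} := by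
    intro t ht
    rcases ht.eq_or_lt with rfl | ht
    · have h : {y | φ y < 0} = ∅ := Set.eq_empty_of_forall_notMem fun y => (hnonneg y).not_gt
      rw [h, measureReal_empty, zero_pow Module.finrank_pos.ne', zero_mul]
    have h : {y | φ y < t} = t • {y | φ y < 1} := by
      ext y
      rw [Set.mem_smul_set_iff_inv_smul_mem₀ ht.ne']
      simp only [Set.mem_ofPred_eq, hhom _ (inv_pos.2 ht)]
      rw [inv_mul_lt_iff₀ ht, mul_one]
    rw [h, measureReal_def, Measure.addHaar_smul, ENNReal.toReal_mul,
      ENNReal.toReal_ofReal (abs_nonneg _), abs_of_pos (pow_pos ht _), measureReal_def]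
  set n := Module.finrank ℝ E
  set s := max 0 (r - δ)
  set t := min (r + δ) R
  have hs : 0 ≤ s := le_max_left _ _
  have hsub : {y | |φ y - r| < δ ∧ φ y < R} ⊆ {y | φ y < t} \ {y | φ y < s} := by
    rintro y ⟨h, h'⟩
    rw [abs_lt] at h
    refine ⟨lt_min (by linarith) h', not_lt.2 (max_le (hnonneg y) (by linarith))⟩
  have hfin' : μ ({y | φ y < t} \ {y | φ y < s}) ≠ ∞ :=
    ((measure_mono sdiff_subset).trans_lt (hfin t).lt_top).ne
  refine (measureReal_mono hsub hfin').trans ?_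
  rcases le_or_gt t s with hts | hst
  · have hts' : {y | φ y < t} ⊆ {y | φ y < s} := fun y hy => lt_of_lt_of_le hy hts
    rw [Set.sdiff_eq_empty.2 hts', measureReal_empty]
    positivity
  have ht : 0 < t := hs.trans_lt hst
  have hst' : {y | φ y < s} ⊆ {y | φ y < t} := fun y hy => lt_trans hy hst
  rw [measureReal_sdiff hst' (hopen s) (hfin t), hscale t ht.le,
    hscale s hs, ← sub_mul, mul_comm]
  gcongr
  calc t ^ n - s ^ n ≤ |t - s| * n * max |t| |s| ^ (n - 1) :=
        (le_abs_self _).trans (abs_pow_sub_pow_le ..)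
    _ ≤ 2 * δ * n * R ^ (n - 1) := by
        rw [abs_of_pos (sub_pos.2 hst), abs_of_pos ht, abs_of_nonneg hs, max_eq_left hst.le]
        have h₁ : r - δ ≤ s := le_max_right _ _
        have h₂ : t ≤ r + δ := min_le_left _ _
        gcongr
        · linarith
        · exact min_le_right _ _

/-- The half-open cube with index `v` in the tiling of `ℝ^d` by cubes of side length `ρ`. -/
def gridCube {ι : Type*} (ρ : ℝ) (v : ι → ℤ) : Set (ι → ℝ) :=
  Set.univ.pi fun i => Set.Ico (v i * ρ) ((v i + 1) * ρ)

theorem mem_gridCube_iff {ι : Type*} {ρ : ℝ} (hρ : 0 < ρ) {v : ι → ℤ} {x : ι → ℝ} :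
    x ∈ gridCube ρ v ↔ (fun i => ⌊x i / ρ⌋) = v := by
  simp only [gridCube, Set.mem_univ_pi, Set.mem_Ico, funext_iff, Int.floor_eq_iff,
    le_div_iff₀ hρ, div_lt_iff₀ hρ]

/-- Grid cubes of side length `ρ` contained in a set of finite measure are bounded in number
by the volume. -/
theorem card_mul_pow_le_of_gridCube_subset {d : ℕ} {ρ : ℝ} (hρ : 0 < ρ)
    (F : Finset (Fin d → ℤ)) {A : Set (Fin d → ℝ)} (hA : volume A ≠ ∞)
    (hF : ∀ v ∈ F, gridCube ρ v ⊆ A) : (F.card : ℝ) * ρ ^ d ≤ volume.real A := by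
  have hvol : ∀ v : Fin d → ℤ, volume.real (gridCube ρ v) = ρ ^ d := by
    intro v
    rw [measureReal_def, gridCube, Real.volume_pi_Ico_toReal]
    · simp [add_mul]
    · intro i
      simp only [add_mul, one_mul]
      linarith
  have hunion : ⋃ v ∈ F, gridCube ρ v ⊆ A := Set.iUnion₂_subset hF
  calc (F.card : ℝ) * ρ ^ d = ∑ v ∈ F, volume.real (gridCube ρ v) := by simp [hvol]
    _ = volume.real (⋃ v ∈ F, gridCube ρ v) := by
        refine (measureReal_biUnion_finset ?_ ?_ ?_).symm
        · intro v _ w _ hvw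
          refine Set.disjoint_left.2 fun x hx hx' => hvw ?_
          rw [← (mem_gridCube_iff hρ).1 hx, (mem_gridCube_iff hρ).1 hx']
        · exact fun v _ => MeasurableSet.univ_pi fun i => measurableSet_Ico
        · exact fun v hv => ((measure_mono (hF v hv)).trans_lt hA.lt_top).ne
    _ ≤ volume.real A := measureReal_mono hunion hA

theorem dist_le_of_mem_gridCube {d : ℕ} {ρ : ℝ} (hρ : 0 ≤ ρ) {v : Fin d → ℤ} {x y : Fin d → ℝ}
    (hx : x ∈ gridCube ρ v) (hy : y ∈ gridCube ρ v) : dist x y ≤ ρ := by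
  refine (dist_pi_le_iff hρ).2 fun i => ?_
  have hxi := hx i (Set.mem_univ i)
  have hyi := hy i (Set.mem_univ i)
  simp only [Set.mem_Ico, add_mul, one_mul] at hxi hyi
  rw [Real.dist_eq, abs_le]
  constructor <;> linarith

/-- Number of grid cubes meeting a translated shell of a positive homogeneous Lipschitz function. -/
theorem card_gridCube_shell_le {d : ℕ} (hd : d ≠ 0) {φ : (Fin d → ℝ) → ℝ} {K : ℝ≥0}
    (hlip : LipschitzWith K φ) {c : ℝ} (hc : 0 < c) (hlow : ∀ x, c * ‖x‖ ≤ φ x)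
    (hhom : ∀ t : ℝ, 0 < t → ∀ x, φ (t • x) = t * φ x) {ρ : ℝ} (hρ : 0 < ρ)
    (F : Finset (Fin d → ℤ)) (r : ℝ) (x₀ : Fin d → ℝ) {δ R : ℝ} (hδ : 0 ≤ δ) (hR : 0 ≤ R)
    (hF : ∀ v ∈ F, ∃ x ∈ gridCube ρ v, |φ (x - x₀) - r| < δ ∧ φ (x - x₀) < R) :
    (F.card : ℝ) * ρ ^ d ≤
      volume.real {y | φ y < 1} * (2 * (δ + K * ρ) * d * (R + K * ρ) ^ (d - 1)) := by
  have : Nonempty (Fin d) := Fin.pos_iff_nonempty.1 (Nat.pos_of_ne_zero hd)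
  obtain ⟨hfin, hle⟩ := measureReal_homogeneous_shell_le volume hlip.continuous hc hlow hhom r
    (by positivity : 0 ≤ δ + K * ρ) (by positivity : 0 ≤ R + K * ρ)
  rw [Module.finrank_fin_fun] at hle
  have hvol := measure_preimage_add_right volume (-x₀)
    {y | |φ y - r| < δ + K * ρ ∧ φ y < R + K * ρ}
  simp only [← sub_eq_add_neg] at hvol
  rw [← hvol] at hfin
  rw [measureReal_def, ← hvol] at hle
  refine (card_mul_pow_le_of_gridCube_subset hρ F hfin fun v hv y hy => ?_).trans hle
  obtain ⟨x, hx, hx₁, hx₂⟩ := hF v hv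
  have h : |φ (y - x₀) - φ (x - x₀)| ≤ K * ρ := by
    rw [← Real.dist_eq]
    refine (hlip.dist_le_mul _ _).trans ?_
    rw [dist_sub_right]
    gcongr
    exact dist_le_of_mem_gridCube hρ.le hy hx
  rw [abs_lt] at hx₁
  rw [abs_le] at h
  refine ⟨abs_lt.2 ⟨?_, ?_⟩, ?_⟩ <;> linarith

theorem embedPt_injective (d : ℕ) : Function.Injective (embedPt d) := by
  rintro ⟨m, v⟩ ⟨m', v'⟩ h
  simpa [embedPt, funext_iff] using h

/-- A density bound on the dyadic cubes of the largest size bounds the number of points of `S`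
by the number of grid cubes that they occupy. -/
theorem card_le_card_image_floor_mul {d k : ℕ} (hk : 1 ≤ k) {E S : Finset (ℕ × (Fin d → ℤ))}
    (hS : S ⊆ E) (hE : ∀ e ∈ E, (2 : ℝ) ^ k ≤ (e.1 : ℝ) ∧ (e.1 : ℝ) < 2 ^ (k + 1)) {B : ℝ}
    (hB : ∀ Q : DyCube d k, (cubeCount (E.image (embedPt d)) Q : ℝ) ≤ B * Q.len) :
    (S.card : ℝ) ≤ (S.image fun e i => ⌊(e.2 i : ℝ) / 2 ^ k⌋).card * (B * 2 ^ k) := by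
  have h2 : (0 : ℝ) < 2 ^ k := by positivity
  set f : ℕ × (Fin d → ℤ) → Fin d → ℤ := fun e i => ⌊(e.2 i : ℝ) / 2 ^ k⌋
  rw [Finset.card_eq_sum_card_image f S, Nat.cast_sum, ← nsmul_eq_mul]
  refine Finset.sum_le_card_nsmul _ _ _ fun v _ => ?_
  refine le_trans ?_ (hB ⟨k, 1, v, ⟨hk, le_rfl⟩, by simp⟩)
  rw [cubeCount, Nat.cast_le]
  refine Finset.card_le_card_of_injOn (embedPt d) ?_ (embedPt_injective d).injOn
  intro e he
  obtain ⟨heS, hev⟩ := Finset.mem_filter.1 he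
  refine Finset.mem_filter.2 ⟨Finset.mem_image_of_mem _ (hS heS), ?_, ?_⟩
  · obtain ⟨h₁, h₂⟩ := hE e (hS heS)
    rw [pow_succ] at h₂
    simp only [embedPt, Int.cast_one]
    constructor <;> linarith
  · intro i
    exact (mem_gridCube_iff (x := fun i => (e.2 i : ℝ)) h2).2 hev i (Set.mem_univ i)

/-- the counting estimate (2.10): under the density hypothesis on `E_k`,
`#E_k^l(n,z) ≲ λ^p 2^{(j-k)(d-1)} 2^{k+l}`, uniformly in `(n,z)`. -/
theorem statement13 (d : ℕ) (hd : 2 ≤ d) (ψ : Rd d → ℝ) (L c₁ c₂ : ℝ) (hc₁ : 0 < c₁)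
    (hψ : IsPsi ψ L c₁ c₂) (C : ℝ) (hC : 0 < C) :
    ∃ C' : ℝ, 0 < C' ∧ ∀ p lam : ℝ, 1 ≤ p → 1 ≤ lam → ∀ j k : ℕ, 1 ≤ k → k < j →
      ∀ Ek : Finset (ℕ × (Fin d → ℤ)),
      (∀ e ∈ Ek, (2 : ℝ) ^ k ≤ (e.1 : ℝ) ∧ (e.1 : ℝ) < 2 ^ (k + 1)) →
      (∀ Q : DyCube d k, (cubeCount (Ek.image (embedPt d)) Q : ℝ) ≤ lam ^ p * Q.len) →
      ∀ n : ℕ, ∀ z : Fin d → ℤ, (2 : ℝ) ^ j ≤ (n : ℝ) → (n : ℝ) < 2 ^ (j + 1) →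
      ∀ l : ℕ,
      ((Ek.filter fun e =>
          (2 : ℝ) ^ ((j : ℤ) - 5) ≤ ψ (latticeVec d (e.2 - z)) ∧
          ψ (latticeVec d (e.2 - z)) ≤ 2 ^ (j + 5) ∧
          (if l = 0 then |ψ (latticeVec d (e.2 - z)) - (n : ℝ)| < C * 2 ^ k
           else C * 2 ^ (k + l - 1) ≤ |ψ (latticeVec d (e.2 - z)) - (n : ℝ)| ∧
             |ψ (latticeVec d (e.2 - z)) - (n : ℝ)| < C * 2 ^ (k + l))).card : ℝ) ≤
        C' * lam ^ p * 2 ^ ((j - k) * (d - 1)) * 2 ^ (k + l) := by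
  have hd0 : d ≠ 0 := by omega
  set φ : (Fin d → ℝ) → ℝ := fun x => ψ (WithLp.toLp 2 x)
  obtain ⟨K, hlip⟩ : ∃ K : ℝ≥0, LipschitzWith K φ :=
    ⟨_, hψ.lip.comp (PiLp.lipschitzWith_toLp 2 fun _ : Fin d => ℝ)⟩
  have hlow : ∀ x, c₁ * ‖x‖ ≤ φ x := fun x => by
    refine le_trans ?_ (hψ.lower _)
    gcongr
    refine (pi_norm_le_iff_of_nonneg (norm_nonneg _)).2 fun i => ?_
    exact PiLp.norm_apply_le (WithLp.toLp 2 x) i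
  have hhom : ∀ t : ℝ, 0 < t → ∀ x, φ (t • x) = t * φ x := fun t ht x => hψ.homog t ht _
  set V := volume.real {y | φ y < 1}
  have hV : 0 ≤ V := measureReal_nonneg
  set M := V * (2 * (C + K) * d * (64 + K) ^ (d - 1)) with hM
  have hM0 : 0 ≤ M := by positivity
  refine ⟨M + 1, by positivity, ?_⟩
  intro p lam hp hlam j k hk hkj E hE hB n z hn hn' l
  have hB0 : 0 ≤ lam ^ p := by positivity
  suffices key : ∀ S ⊆ E, (∀ e ∈ S, ψ (latticeVec d (e.2 - z)) ≤ 2 ^ (j + 5) ∧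
      |ψ (latticeVec d (e.2 - z)) - (n : ℝ)| < C * 2 ^ (k + l)) →
      (S.card : ℝ) ≤ (M + 1) * lam ^ p * 2 ^ ((j - k) * (d - 1)) * 2 ^ (k + l) by
    refine key _ (Finset.filter_subset _ _) fun e he => ?_
    obtain ⟨-, -, he₁, he₂⟩ := Finset.mem_filter.1 he
    refine ⟨he₁, ?_⟩
    split_ifs at he₂ with hl
    · simpa [hl] using he₂
    · exact he₂.2
  intro S hSE hS
  set F := S.image fun e i => ⌊(e.2 i : ℝ) / 2 ^ k⌋
  have hcard : (S.card : ℝ) ≤ F.card * (lam ^ p * 2 ^ k) :=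
    card_le_card_image_floor_mul hk hSE hE hB
  have h2k : (0 : ℝ) < 2 ^ k := by positivity
  have hF := card_gridCube_shell_le hd0 hlip hc₁ hlow hhom h2k F n (fun i => (z i : ℝ))
    (by positivity : (0 : ℝ) ≤ C * 2 ^ (k + l)) (by positivity : (0 : ℝ) ≤ 2 ^ (j + 6)) (by
      intro v hv
      obtain ⟨e, he, rfl⟩ := Finset.mem_image.1 hv
      obtain ⟨he₁, he₂⟩ := hS e he
      have hφ : φ ((fun i => (e.2 i : ℝ)) - fun i => (z i : ℝ)) =
          ψ (latticeVec d (e.2 - z)) := by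
        simp only [φ, latticeVec, Pi.sub_apply, Int.cast_sub]
        rfl
      refine ⟨fun i => (e.2 i : ℝ), (mem_gridCube_iff h2k).2 rfl, ?_, ?_⟩
      · rwa [hφ]
      · rw [hφ]
        exact he₁.trans_lt (pow_lt_pow_right₀ one_lt_two (by omega)))
  have hbound : (F.card : ℝ) * 2 ^ k ≤ M * 2 ^ ((j - k) * (d - 1)) * 2 ^ (k + l) := by
    have hkl : (2 : ℝ) ^ k ≤ 2 ^ (k + l) := pow_le_pow_right₀ one_le_two (by omega)
    have hkj' : (2 : ℝ) ^ k ≤ 2 ^ j := pow_le_pow_right₀ one_le_two hkj.le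
    have h₁ : C * 2 ^ (k + l) + K * 2 ^ k ≤ (C + K) * (2 : ℝ) ^ (k + l) := by
      rw [add_mul]; gcongr
    have h₂ : 2 ^ (j + 6) + K * 2 ^ k ≤ (64 + K) * (2 : ℝ) ^ j := by
      have h : (2 : ℝ) ^ (j + 6) = 64 * 2 ^ j := by ring
      rw [add_mul, h]
      gcongr
    have hpow : ((2 : ℝ) ^ j) ^ (d - 1) = 2 ^ ((j - k) * (d - 1)) * (2 ^ k) ^ (d - 1) := by
      rw [pow_mul, ← mul_pow, ← pow_add, Nat.sub_add_cancel hkj.le]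
    refine le_of_mul_le_mul_right ?_ (by positivity : (0 : ℝ) < (2 ^ k) ^ (d - 1))
    calc (F.card : ℝ) * 2 ^ k * (2 ^ k) ^ (d - 1) = F.card * (2 ^ k) ^ d := by
          rw [mul_assoc, mul_pow_sub_one hd0]
      _ ≤ V * (2 * (C * 2 ^ (k + l) + K * 2 ^ k) * d * (2 ^ (j + 6) + K * 2 ^ k) ^ (d - 1)) := hF
      _ ≤ V * (2 * ((C + K) * 2 ^ (k + l)) * d * ((64 + K) * 2 ^ j) ^ (d - 1)) := by gcongr
      _ = M * 2 ^ ((j - k) * (d - 1)) * 2 ^ (k + l) * (2 ^ k) ^ (d - 1) := by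
          rw [mul_pow, hpow, hM]; ring
  calc (S.card : ℝ) ≤ lam ^ p * (F.card * 2 ^ k) := by linarith
    _ ≤ lam ^ p * (M * 2 ^ ((j - k) * (d - 1)) * 2 ^ (k + l)) := by gcongr
    _ = M * lam ^ p * 2 ^ ((j - k) * (d - 1)) * 2 ^ (k + l) := by ring
    _ ≤ (M + 1) * lam ^ p * 2 ^ ((j - k) * (d - 1)) * 2 ^ (k + l) := by
        gcongr
        linarith
end
end

section
/- Let d ≥ 2 and 1 < p < 2d/(d+1). Then the function r ↦ (1+|r|)^{−(d−1)/2} belongs to the Lorentz space L^{p′,1}(ν_d), and consequently there is a constant C such that for every measurable function κ on ℝ, ∫_ℝ |κ(r)| dr ≤ C ‖ κ / (1+|·|)^{(d−1)/2} ‖_{L^{p,∞}(ν_d)}. -/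
open MeasureTheory Real Set
open scoped Classical FourierTransform RealInnerProductSpace NNReal ENNReal

noncomputable section

theorem lintegral_le_of_meas_lt_le_rpow {α : Type*} [MeasurableSpace α] {μ : Measure α}
    {g : α → ℝ} (hg : 0 ≤ g) (hgm : AEMeasurable g μ) {p N V : ℝ} (hp : 1 < p) (hN : 0 < N)
    (hV : 0 < V) (hμ : μ univ ≤ ENNReal.ofReal V)
    (hweak : ∀ s : ℝ, 0 < s → μ {x | s < g x} ≤ ENNReal.ofReal (N ^ p * s ^ (-p))) :
    ∫⁻ x, ENNReal.ofReal (g x) ∂μ ≤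
      ENNReal.ofReal (p / (p - 1) * N * V ^ (1 / (p / (p - 1)))) := by
  have hp0 : 0 < p := by linarith
  have hp1 : 0 < p - 1 := by linarith
  set S : ℝ := N * V ^ (-(1 / p)) with hS
  have hS0 : 0 < S := by positivity
  have hint : IntegrableOn (fun s : ℝ => N ^ p * s ^ (-p)) (Ioi S) :=
    (integrableOn_Ioi_rpow_of_lt (by linarith) hS0).const_mul _
  have hSV : S * V = N * V ^ (1 / (p / (p - 1))) := by
    rw [hS, mul_assoc, ← Real.rpow_add_one hV.ne']
    congr 2
    field_simp
    ring
  have htail : N ^ p * S ^ (-p + 1) = N * V ^ (1 / (p / (p - 1))) := by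
    rw [hS, Real.mul_rpow hN.le (by positivity), ← Real.rpow_mul hV.le, ← mul_assoc,
      ← Real.rpow_add hN]
    congr 2
    · rw [show p + (-p + 1) = 1 by ring, Real.rpow_one]
    · field_simp
      ring
  rw [lintegral_eq_lintegral_meas_lt μ (Filter.Eventually.of_forall hg) hgm,
    ← Ioc_union_Ioi_eq_Ioi hS0.le]
  calc ∫⁻ s in Ioc 0 S ∪ Ioi S, μ {x | s < g x}
      ≤ (∫⁻ s in Ioc 0 S, μ {x | s < g x}) + ∫⁻ s in Ioi S, μ {x | s < g x} :=
        lintegral_union_le _ _ _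
    _ ≤ (∫⁻ _ in Ioc 0 S, ENNReal.ofReal V) +
          ∫⁻ s in Ioi S, ENNReal.ofReal (N ^ p * s ^ (-p)) := by
        refine add_le_add (lintegral_mono fun s => (measure_mono (subset_univ _)).trans hμ)
          (setLIntegral_mono' measurableSet_Ioi fun s hs => hweak s (hS0.trans hs))
    _ = ENNReal.ofReal (S * V) + ENNReal.ofReal (N ^ p * (S ^ (-p + 1) / (p - 1))) := by
        congr 1
        · rw [setLIntegral_const, Real.volume_Ioc, sub_zero, mul_comm,
            ENNReal.ofReal_mul hS0.le]
        · rw [← ofReal_integral_eq_lintegral_ofReal hint, integral_const_mul,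
            integral_Ioi_rpow_of_lt (by linarith) hS0]
          · congr 2
            rw [show -p + 1 = -(p - 1) by ring, neg_div_neg_eq]
          · filter_upwards [ae_restrict_mem measurableSet_Ioi] with s hs
            have : 0 < s := hS0.trans hs
            positivity
    _ = _ := by
        rw [← ENNReal.ofReal_add (by positivity) (by positivity), ← mul_div_assoc, htail, hSV]
        congr 1
        field_simp
        ring

theorem meas_lt_le_of_lorentzNorm_top_le {α E : Type*} [MeasurableSpace α]
    [NormedAddCommGroup E] {μ : Measure α} {p N : ℝ} (hp : 0 < p) (hN : 0 ≤ N) {f : α → E}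
    (h : lorentzNorm μ p ∞ f ≤ ENNReal.ofReal N) {s : ℝ} (hs : 0 < s) :
    μ {x | s < ‖f x‖} ≤ ENNReal.ofReal (N ^ p * s ^ (-p)) := by
  rw [lorentzNorm, if_pos rfl] at h
  have h1 := (le_iSup (fun t : ℝ => ENNReal.ofReal t * μ {x | t < ‖f x‖} ^ (1 / p)) s).trans h
  rw [mul_comm, ← ENNReal.le_div_iff_mul_le (.inl (by simpa using hs)) (.inl (by simp)),
    ← ENNReal.ofReal_div_of_pos hs, one_div, ENNReal.rpow_inv_le_iff hp,
    ENNReal.ofReal_rpow_of_nonneg (by positivity) hp.le, Real.div_rpow hN hs.le] at h1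
  rwa [Real.rpow_neg hs.le, ← div_eq_mul_inv]

theorem nuMeas_weight_superlevel_le {d : ℕ} (hd : 1 ≤ d) {a t : ℝ} (ha : 0 < a) (ht : 0 < t) :
    nuMeas d {r : ℝ | t < (1 + |r|) ^ (-a)} ≤ ENNReal.ofReal (2 * t ^ (-(d / a))) := by
  set R : ℝ := t ^ (-(1 / a)) with hR
  have hR0 : 0 < R := by positivity
  have hRd : R ^ (d - 1) * (2 * R) = 2 * t ^ (-(d / a)) := by
    rw [mul_left_comm, ← pow_succ, Nat.sub_add_cancel hd, hR, ← Real.rpow_mul_natCast ht.le]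
    congr 2
    ring
  have hsub : {r : ℝ | t < (1 + |r|) ^ (-a)} ⊆ {r : ℝ | 1 + |r| < R} := by
    intro r hr
    have hr0 : 0 < 1 + |r| := by positivity
    have := Real.rpow_lt_rpow_of_neg ht hr (z := -(1 / a)) (by simpa using ha)
    rwa [← Real.rpow_mul hr0.le, show -a * -(1 / a) = 1 by field_simp, Real.rpow_one] at this
  have hmeas : MeasurableSet {r : ℝ | 1 + |r| < R} :=
    measurableSet_lt (by fun_prop) measurable_const
  calc nuMeas d {r : ℝ | t < (1 + |r|) ^ (-a)}
      ≤ nuMeas d {r : ℝ | 1 + |r| < R} := measure_mono hsub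
    _ = ∫⁻ r in {r : ℝ | 1 + |r| < R}, ENNReal.ofReal ((1 + |r|) ^ (d - 1)) :=
        withDensity_apply _ hmeas
    _ ≤ ∫⁻ _ in {r : ℝ | 1 + |r| < R}, ENNReal.ofReal (R ^ (d - 1)) :=
        setLIntegral_mono' hmeas fun r hr =>
          ENNReal.ofReal_le_ofReal (pow_le_pow_left₀ (by positivity) (le_of_lt hr) _)
    _ ≤ ENNReal.ofReal (R ^ (d - 1)) * volume (Ioo (-R) R) := by
        rw [setLIntegral_const]
        gcongr
        intro r hr
        have hr' : 1 + |r| < R := hr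
        exact abs_lt.1 (by linarith)
    _ = _ := by
        rw [Real.volume_Ioo, ← ENNReal.ofReal_mul (by positivity), ← hRd]
        congr 2
        ring

theorem weight_superlevel_eq_empty {a t : ℝ} (ha : 0 ≤ a) (ht : 1 ≤ t) :
    {r : ℝ | t < (1 + |r|) ^ (-a)} = ∅ := by
  refine eq_empty_of_forall_notMem fun r hr => ?_
  have : (1 + |r|) ^ (-a) ≤ 1 :=
    Real.rpow_le_one_of_one_le_of_nonpos (by linarith [abs_nonneg r]) (by linarith)
  exact absurd (lt_of_lt_of_le hr this) (not_lt.2 ht)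

theorem lintegral_Ioi_le_of_eq_zero {F G : ℝ → ℝ≥0∞} (hF : ∀ t, 0 < t → t < 1 → F t ≤ G t)
    (hF0 : ∀ t, 1 ≤ t → F t = 0) :
    ∫⁻ t in Ioi 0, F t ≤ ∫⁻ t in Ioo 0 1, G t := by
  rw [← Ioo_union_Ici_eq_Ioi (zero_lt_one' ℝ)]
  refine (lintegral_union_le _ _ _).trans ?_
  rw [setLIntegral_congr_fun measurableSet_Ici hF0, lintegral_zero, add_zero]
  exact setLIntegral_mono' measurableSet_Ioo fun t ht => hF t ht.1 ht.2

theorem lintegral_Ioo_ofReal_rpow_rpow_lt_top {b s : ℝ} (hbs : b * s < 1) :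
    ∫⁻ t in Ioo (0 : ℝ) 1, ENNReal.ofReal ((2 * t ^ (-b)) ^ s) < ∞ := by
  have hint : IntegrableOn (fun t : ℝ => 2 ^ s * t ^ (-b * s)) (Ioo 0 1) :=
    ((intervalIntegral.integrableOn_Ioo_rpow_iff one_pos).2 (by linarith)).const_mul _
  refine lt_of_eq_of_lt (setLIntegral_congr_fun measurableSet_Ioo fun t ht => ?_)
    (hint.lintegral_lt_top)
  have ht0 : 0 < t := ht.1
  rw [Real.mul_rpow (by norm_num) (by positivity), ← Real.rpow_mul ht0.le]

theorem lintegral_nnnorm_eq_lintegral_nuMeas {d : ℕ} (hd : 1 ≤ d) {κ : ℝ → ℂ}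
    (hκ : Measurable κ) :
    ∫⁻ r : ℝ, (‖κ r‖₊ : ℝ≥0∞) =
      ∫⁻ r : ℝ, ENNReal.ofReal ((1 + |r|) ^ (-(((d : ℝ) - 1) / 2)))
        ∂(nuMeas d).withDensity fun r => ENNReal.ofReal
          ‖κ r / (((1 + |r|) ^ (((d : ℝ) - 1) / 2) : ℝ) : ℂ)‖ := by
  have hw : ∀ c : ℝ, Measurable fun r : ℝ => (1 + |r|) ^ c := fun c => by fun_prop
  rw [lintegral_withDensity_eq_lintegral_mul _ (by fun_prop) (by fun_prop), nuMeas,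
    lintegral_withDensity_eq_lintegral_mul _ (by fun_prop) (by fun_prop)]
  refine lintegral_congr fun r => ?_
  have hr : 0 < 1 + |r| := by positivity
  simp only [Pi.mul_apply]
  rw [← ENNReal.ofReal_mul (by positivity), ← ENNReal.ofReal_mul (by positivity),
    ← enorm_eq_nnnorm, ← ofReal_norm, norm_div, Complex.norm_real,
    Real.norm_of_nonneg (by positivity), Real.rpow_neg hr.le]
  congr 1
  have h2 : (1 + |r|) ^ (d - 1) =
      (1 + |r|) ^ (((d : ℝ) - 1) / 2) * (1 + |r|) ^ (((d : ℝ) - 1) / 2) := by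
    rw [← Real.rpow_add hr, ← Real.rpow_natCast]
    congr 1
    push_cast [Nat.cast_sub hd]
    ring
  rw [h2]
  field_simp

/-- For `d ≥ 2` and `1 < p < 2d/(d+1)`, the function
`r ↦ (1+|r|)^{-(d-1)/2}` belongs to `L^{p',1}(ν_d)`, and consequently
`∫ |κ| ≤ C ‖κ/(1+|·|)^{(d-1)/2}‖_{L^{p,∞}(ν_d)}`. -/
theorem statement19 (d : ℕ) (hd : 2 ≤ d) (p : ℝ) (hp1 : 1 < p)
    (hp2 : p < 2 * (d : ℝ) / ((d : ℝ) + 1)) :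
    lorentzNorm (nuMeas d) (p / (p - 1)) 1
        (fun r : ℝ => ((1 + |r|) ^ (-(((d : ℝ) - 1) / 2)) : ℝ)) < ∞ ∧
      ∃ C : ℝ, 0 < C ∧ ∀ κ : ℝ → ℂ, Measurable κ →
        (∫⁻ r : ℝ, (‖κ r‖₊ : ℝ≥0∞)) ≤ ENNReal.ofReal C *
          lorentzNorm (nuMeas d) p ∞
            (fun r : ℝ => κ r / (((1 + |r|) ^ (((d : ℝ) - 1) / 2) : ℝ) : ℂ)) := by
  have hdR : (2 : ℝ) ≤ d := by exact_mod_cast hd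
  have hd1 : 1 ≤ d := by omega
  set a : ℝ := ((d : ℝ) - 1) / 2 with ha_def
  set q : ℝ := p / (p - 1) with hq
  have ha : 0 < a := by rw [ha_def]; linarith
  have hp0 : 0 < p := by linarith
  have hp10 : 0 < p - 1 := by linarith
  have hq0 : 0 < q := by positivity
  have hexp : d / a * (1 / q) < 1 := by
    rw [lt_div_iff₀ (by positivity)] at hp2
    rw [div_mul_div_comm, mul_one, div_lt_one (by positivity), hq, ha_def, ← mul_div_assoc,
      lt_div_iff₀ hp10]
    nlinarith
  set I : ℝ≥0∞ := ∫⁻ t in Ioo (0 : ℝ) 1, ENNReal.ofReal ((2 * t ^ (-(d / a))) ^ (1 / q)) with hI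
  have hItop : I < ∞ := lintegral_Ioo_ofReal_rpow_rpow_lt_top hexp
  refine ⟨?_, q * I.toReal + 1, by positivity, fun κ hκ => ?_⟩
  · rw [lorentzNorm, if_neg ENNReal.one_ne_top]
    simp only [ENNReal.toReal_one, div_one, ENNReal.rpow_one]
    refine (lintegral_Ioi_le_of_eq_zero (fun t ht _ => ?_) fun t ht => ?_).trans_lt hItop
    · rw [mul_comm, ENNReal.mul_div_cancel_right (by simpa using ht) (by simp),
        ← ENNReal.ofReal_rpow_of_nonneg (by positivity) (by positivity)]
      gcongr
      refine le_trans (measure_mono fun r hr => ?_) (nuMeas_weight_superlevel_le hd1 ha ht)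
      rwa [mem_ofPred_eq, Real.norm_of_nonneg (by positivity)] at hr
    · have : {r : ℝ | t < ‖(1 + |r|) ^ (-a)‖} = ∅ := by
        rw [← weight_superlevel_eq_empty ha.le ht]
        ext r
        rw [mem_ofPred_eq, mem_ofPred_eq, Real.norm_of_nonneg (by positivity)]
      rw [this, measure_empty, ENNReal.zero_rpow_of_pos (by positivity), mul_zero,
        ENNReal.zero_div]
  · set f : ℝ → ℂ := fun r => κ r / (((1 + |r|) ^ a : ℝ) : ℂ) with hf
    have hfm : Measurable f := by fun_prop
    have key : ∀ N : ℝ, 0 < N → lorentzNorm (nuMeas d) p ∞ f ≤ ENNReal.ofReal N →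
        ∫⁻ r : ℝ, (‖κ r‖₊ : ℝ≥0∞) ≤ ENNReal.ofReal (q * I.toReal + 1) * ENNReal.ofReal N := by
      intro N hN hfN
      rw [lintegral_nnnorm_eq_lintegral_nuMeas hd1 hκ, lintegral_eq_lintegral_meas_lt _
        (Filter.Eventually.of_forall fun r => by positivity) (by fun_prop)]
      calc _ ≤ ∫⁻ t in Ioo (0 : ℝ) 1, ENNReal.ofReal (q * N) *
              ENNReal.ofReal ((2 * t ^ (-(d / a))) ^ (1 / q)) := by
            refine lintegral_Ioi_le_of_eq_zero (fun t ht _ => ?_) fun t ht => ?_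
            · rw [withDensity_apply _ (measurableSet_lt measurable_const (by fun_prop)),
                ← ENNReal.ofReal_mul (by positivity)]
              refine lintegral_le_of_meas_lt_le_rpow (fun r => norm_nonneg _) (by fun_prop) hp1 hN
                (by positivity) ?_ fun s hs => ?_
              · rw [Measure.restrict_apply_univ]
                exact nuMeas_weight_superlevel_le hd1 ha ht
              · exact (Measure.restrict_apply_le _ _).trans
                  (meas_lt_le_of_lorentzNorm_top_le hp0 hN.le hfN hs)
            · rw [weight_superlevel_eq_empty ha.le ht, measure_empty]
        _ = ENNReal.ofReal (q * N) * I := lintegral_const_mul' _ _ ENNReal.ofReal_ne_top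
        _ = ENNReal.ofReal (q * I.toReal) * ENNReal.ofReal N := by
            rw [← ENNReal.ofReal_toReal hItop.ne, ← ENNReal.ofReal_mul (by positivity),
              ← ENNReal.ofReal_mul (by positivity), ENNReal.toReal_ofReal (by positivity)]
            congr 1
            ring
        _ ≤ _ := by
            gcongr
            linarith
    set L := lorentzNorm (nuMeas d) p ∞ f
    set C : ℝ := q * I.toReal + 1 with hC
    have hC0 : 0 < C := by positivity
    by_cases hL : L = ∞
    · rw [hL, ENNReal.mul_top (by simpa using hC0)]
      exact le_top
    refine ENNReal.le_of_forall_pos_le_add fun ε hε _ => ?_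
    have hεC : 0 < (ε : ℝ) / C := by positivity
    have hN : ENNReal.ofReal (L.toReal + ε / C) = L + ENNReal.ofReal (ε / C) := by
      rw [ENNReal.ofReal_add (by positivity) hεC.le, ENNReal.ofReal_toReal hL]
    refine (key (L.toReal + ε / C) (by positivity) (hN ▸ le_self_add)).trans_eq ?_
    rw [hN, mul_add, ← ENNReal.ofReal_mul hC0.le, mul_div_cancel₀ _ hC0.ne',
      ENNReal.ofReal_coe_nnreal]
end
end
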